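/- Let λ be a partition with at most n rows. Then, as polynomials in ℤ[β][x_1,…,x_n], 𝔊_λ(x_1,…,x_n;β) = Σ_μ β^{|μ|−|λ|} M_λ^μ s_μ(x_1,…,x_n), where the sum runs over partitions μ with at most n parts, M_λ^μ is the number of Yamanouchi elements of SVT^n(λ) of weight μ, and M_λ^μ = 0 unless |μ| ≥ |λ| (so all exponents of β are nonnegative and only finitely many terms are nonzero). -/

import Mathlib

open scoped Classical

noncomputable section

namespace SVTCrystal

/-- A filling assigns to each (row, column) position (0-indexed) a finite set of entries. -/
abbrev Filling : Type := ℕ → ℕ → Finset ℕ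

/-- `lam` is a partition shape with at most `n` rows. -/
def IsPartitionShape (n : ℕ) (lam : ℕ → ℕ) : Prop :=
  (∀ r, lam (r + 1) ≤ lam r) ∧ (∀ r, n ≤ r → lam r = 0)

/-- Semistandard set-valued tableau of shape `lam` with entries in `{1,…,n}`. -/
structure IsSVT (n : ℕ) (lam : ℕ → ℕ) (t : Filling) : Prop where
  boxNonempty : ∀ r c, c < lam r → (t r c).Nonempty
  emptyOutside : ∀ r c, ¬ c < lam r → t r c = ∅
  entryBounds : ∀ r c a, a ∈ t r c → 1 ≤ a ∧ a ≤ n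
  rowWeak : ∀ r c a b, a ∈ t r c → b ∈ t r (c + 1) → a ≤ b
  colStrict : ∀ r c a b, a ∈ t r c → b ∈ t (r + 1) c → a < b

/-- Semistandard Young tableau: a set-valued tableau all of whose boxes are singletons. -/
def IsSSYT (n : ℕ) (lam : ℕ → ℕ) (t : Filling) : Prop :=
  IsSVT n lam t ∧ ∀ r c, c < lam r → (t r c).card = 1

/-- The weight: `wt n lam t j` is the number of boxes of `t` containing the entry `j`. -/
def wt (n : ℕ) (lam : ℕ → ℕ) (t : Filling) (j : ℕ) : ℕ :=
  ((Finset.range n ×ˢ Finset.range (lam 0)).filter (fun p => j ∈ t p.1 p.2)).card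

/-- The excess: total number of extra entries. -/
def excess (n : ℕ) (lam : ℕ → ℕ) (t : Filling) : ℕ :=
  ∑ p ∈ Finset.range n ×ˢ Finset.range (lam 0), ((t p.1 p.2).card - 1)

/-- Column `c` contains the entry `a`. -/
def colHas (n : ℕ) (t : Filling) (a c : ℕ) : Prop := ∃ r, r < n ∧ a ∈ t r c

/-- The sign of column `c` for the `i`-signature rule: `+` (true) if the column contains `i`
but not `i+1`, `-` (false) if it contains `i+1` but not `i`. -/
def colSign (n : ℕ) (t : Filling) (i c : ℕ) : Option Bool :=
  if colHas n t i c ∧ ¬ colHas n t (i + 1) c then some true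
  else if colHas n t (i + 1) c ∧ ¬ colHas n t i c then some false
  else none

/-- The number of `-` (false) signs left uncanceled after scanning the word left-to-right,
iteratively canceling `-+` pairs. -/
def mctr (w : List Bool) : ℕ := w.foldl (fun cnt b => if b then cnt - 1 else cnt + 1) 0

/-- The number of `+` (true) signs left uncanceled, scanning right-to-left. -/
def pctr (w : List Bool) : ℕ := w.foldr (fun b cnt => if b then cnt + 1 else cnt - 1) 0

/-- The word of column signs of the columns before column `c`. -/
def colWordBefore (n : ℕ) (t : Filling) (i c : ℕ) : List Bool :=
  (List.range c).filterMap (colSign n t i)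

/-- The word of column signs of the columns after column `c` (among columns `< ncols`). -/
def colWordAfter (n ncols : ℕ) (t : Filling) (i c : ℕ) : List Bool :=
  ((List.range ncols).drop (c + 1)).filterMap (colSign n t i)

/-- Column `c` carries an uncanceled `+` for the `i`-signature rule. -/
def PlusCol (n ncols : ℕ) (t : Filling) (i c : ℕ) : Prop :=
  c < ncols ∧ colSign n t i c = some true ∧ mctr (colWordBefore n t i c) = 0

/-- Column `c` carries an uncanceled `-` for the `i`-signature rule. -/
def MinusCol (n ncols : ℕ) (t : Filling) (i c : ℕ) : Prop :=
  c < ncols ∧ colSign n t i c = some false ∧ pctr (colWordAfter n ncols t i c) = 0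

/-- Column `c` is the rightmost uncanceled `+`. -/
def fBoxCol (n ncols : ℕ) (t : Filling) (i c : ℕ) : Prop :=
  PlusCol n ncols t i c ∧ ∀ c', PlusCol n ncols t i c' → c' ≤ c

/-- Column `c` is the leftmost uncanceled `-`. -/
def eBoxCol (n ncols : ℕ) (t : Filling) (i c : ℕ) : Prop :=
  MinusCol n ncols t i c ∧ ∀ c', MinusCol n ncols t i c' → c ≤ c'

/-- Replace the content of the box in row `r`, column `c` by `A`. -/
def updateBox (t : Filling) (r c : ℕ) (A : Finset ℕ) : Filling :=
  fun r' c' => if r' = r ∧ c' = c then A else t r' c'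

/-- The set-valued crystal operator `f_i` (signature rule). -/
def fRaw (n : ℕ) (lam : ℕ → ℕ) (i : ℕ) (t : Filling) : Option Filling :=
  if h : ∃ c, fBoxCol n (lam 0) t i c then
    let c := Classical.choose h
    if hr : ∃ r, r < n ∧ i ∈ t r c then
      let r := Classical.choose hr
      if i ∈ t r (c + 1) then
        some (updateBox (updateBox t r (c + 1) ((t r (c + 1)).erase i)) r c
          (insert (i + 1) (t r c)))
      else some (updateBox t r c (insert (i + 1) ((t r c).erase i)))
    else none
  else none

/-- The set-valued crystal operator `e_i` (signature rule). -/
def eRaw (n : ℕ) (lam : ℕ → ℕ) (i : ℕ) (t : Filling) : Option Filling :=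
  if h : ∃ c, eBoxCol n (lam 0) t i c then
    let c := Classical.choose h
    if hr : ∃ r, r < n ∧ (i + 1) ∈ t r c then
      let r := Classical.choose hr
      if 0 < c ∧ (i + 1) ∈ t r (c - 1) then
        some (updateBox (updateBox t r (c - 1) ((t r (c - 1)).erase (i + 1))) r c
          (insert i (t r c)))
      else some (updateBox t r c (insert i ((t r c).erase (i + 1))))
    else none
  else none

/-- Iterate a partially-defined operator. -/
def iterOpt (g : Filling → Option Filling) : ℕ → Filling → Option Filling
  | 0, t => some t
  | m + 1, t => (iterOpt g m t).bind g

/-- Highest weight (Yamanouchi) elements. -/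
def IsYamanouchi (n : ℕ) (lam : ℕ → ℕ) (t : Filling) : Prop :=
  ∀ i, 1 ≤ i → i < n → eRaw n lam i t = none

/-- Closure of `t0` under the crystal operators `e_i`, `f_i` for `1 ≤ i < n`. -/
inductive Reach (n : ℕ) (lam : ℕ → ℕ) (t0 : Filling) : Filling → Prop
  | base : Reach n lam t0 t0
  | stepF : ∀ {t t' : Filling} (i : ℕ), 1 ≤ i → i < n → Reach n lam t0 t →
      fRaw n lam i t = some t' → Reach n lam t0 t'
  | stepE : ∀ {t t' : Filling} (i : ℕ), 1 ≤ i → i < n → Reach n lam t0 t →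
      eRaw n lam i t = some t' → Reach n lam t0 t'

/-- The one-row partition `(s)`. -/
def rowShape (s : ℕ) : ℕ → ℕ := fun r => if r = 0 then s else 0

/-- The one-column partition `(1^k)`. -/
def colShape (k : ℕ) : ℕ → ℕ := fun r => if r < k then 1 else 0

/-- The hook partition `(s, 1^e)`. -/
def hookShape (s e : ℕ) : ℕ → ℕ := fun r => if r = 0 then s else if r ≤ e then 1 else 0

/-! ### K-theory crystal operators (for single rows and single columns) -/

/-- Some box of the tableau contains the entry `a`. -/
def containsEntry (n : ℕ) (lam : ℕ → ℕ) (t : Filling) (a : ℕ) : Prop :=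
  ∃ r c, r < n ∧ c < lam r ∧ a ∈ t r c

/-- `p` is the rightmost box of `t` containing `i`. -/
def KBoxF (n : ℕ) (lam : ℕ → ℕ) (t : Filling) (i : ℕ) (p : ℕ × ℕ) : Prop :=
  p.1 < n ∧ p.2 < lam p.1 ∧ i ∈ t p.1 p.2 ∧
    ∀ q : ℕ × ℕ, q.1 < n → q.2 < lam q.1 → i ∈ t q.1 q.2 → q.2 ≤ p.2

/-- The K-crystal operator `f_i^K`: if `i` occurs in `t` and `i+1` does not, add `i+1` to
the rightmost box containing `i`; otherwise `0`. -/
def fK (n : ℕ) (lam : ℕ → ℕ) (i : ℕ) (t : Filling) : Option Filling :=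
  if h : (∃ p : ℕ × ℕ, KBoxF n lam t i p) ∧ ¬ containsEntry n lam t (i + 1) then
    let p := Classical.choose h.1
    some (updateBox t p.1 p.2 (insert (i + 1) (t p.1 p.2)))
  else none

/-- The K-crystal operator `e_i^K`: delete `i+1` from the box containing both `i` and `i+1`,
if such a box exists; otherwise `0`. -/
def eK (n : ℕ) (lam : ℕ → ℕ) (i : ℕ) (t : Filling) : Option Filling :=
  if h : ∃ p : ℕ × ℕ, p.1 < n ∧ p.2 < lam p.1 ∧ i ∈ t p.1 p.2 ∧ (i + 1) ∈ t p.1 p.2 then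
    let p := Classical.choose h
    some (updateBox t p.1 p.2 ((t p.1 p.2).erase (i + 1)))
  else none

/-- `t'` is the result of applying `g` to `t` as many times as possible. -/
def MaxApply (g : Filling → Option Filling) (t t' : Filling) : Prop :=
  (∃ m, iterOpt g m t = some t') ∧ g t' = none

/-- One Demazure step: apply `e_i` as many times as possible, then `e_i^K` as many times
as possible (here `eKop i` is the `i`-th K-operator). -/
def DemStep (n : ℕ) (lam : ℕ → ℕ) (eKop : ℕ → Filling → Option Filling) (i : ℕ)
    (t t' : Filling) : Prop :=
  ∃ t1, MaxApply (eRaw n lam i) t t1 ∧ MaxApply (eKop i) t1 t'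

/-- `DemReach n lam eKop [i₁,…,iℓ] t u` holds when
`u = (e_{iℓ}^K)^max e_{iℓ}^max ⋯ (e_{i₁}^K)^max e_{i₁}^max t`. -/
def DemReach (n : ℕ) (lam : ℕ → ℕ) (eKop : ℕ → Filling → Option Filling) :
    List ℕ → Filling → Filling → Prop
  | [], t, u => t = u
  | i :: rest, t, u => ∃ t2, DemStep n lam eKop i t t2 ∧ DemReach n lam eKop rest t2 u

/-- The minimal highest weight tableau `u_λ`, whose row `r` boxes are all `{r+1}`. -/
def uTab (lam : ℕ → ℕ) : Filling := fun r c => if c < lam r then {r + 1} else ∅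

/-- The K-Demazure crystal associated with a word `[i₁,…,iℓ]`. -/
def KDem (n : ℕ) (lam : ℕ → ℕ) (eKop : ℕ → Filling → Option Filling) (word : List ℕ) :
    Set Filling :=
  {t | IsSVT n lam t ∧ DemReach n lam eKop word t (uTab lam)}

/-! ### Permutations and reduced words -/

/-- The permutation `s_{i₁} ⋯ s_{iℓ}` of a word `[i₁,…,iℓ]`, where `s_i` swaps `i`, `i+1`. -/
def wordPerm (word : List ℕ) : Equiv.Perm ℕ :=
  (word.map fun i => Equiv.swap i (i + 1)).prod

/-- `word` is a reduced word for `w` in the Coxeter generators `s_1, …, s_{n-1}`. -/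
def IsReducedWord (n : ℕ) (w : Equiv.Perm ℕ) (word : List ℕ) : Prop :=
  (∀ i ∈ word, 1 ≤ i ∧ i < n) ∧ wordPerm word = w ∧
    ∀ word' : List ℕ, (∀ i ∈ word', 1 ≤ i ∧ i < n) → wordPerm word' = w →
      word.length ≤ word'.length

/-- The Coxeter length of a permutation of `{1,…,n}`. -/
def permLength (n : ℕ) (σ : Equiv.Perm ℕ) : ℕ :=
  sInf {l | ∃ word : List ℕ, (∀ i ∈ word, 1 ≤ i ∧ i < n) ∧ wordPerm word = σ ∧
    word.length = l}

/-- The parabolic subgroup generated by `s_2, …, s_{n-1}`. -/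
def parabolic (n : ℕ) : Subgroup (Equiv.Perm ℕ) :=
  Subgroup.closure {σ | ∃ i, 2 ≤ i ∧ i < n ∧ σ = Equiv.swap i (i + 1)}

/-! ### Polynomials -/

/-- Polynomials in `x₁, x₂, …` over `ℤ[β]`; the variable `β` is `Polynomial.X`. -/
abbrev KPoly : Type := MvPolynomial ℕ (Polynomial ℤ)

/-- The scalar `β`. -/
def betaP : KPoly := MvPolynomial.C Polynomial.X

/-- The monomial `x^{wt(T)} = x₁^{wt₁} ⋯ xₙ^{wtₙ}`. -/
def xwt (n : ℕ) (lam : ℕ → ℕ) (t : Filling) : KPoly :=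
  ∏ j ∈ Finset.Icc 1 n, (MvPolynomial.X j : KPoly) ^ wt n lam t j

/-- The β-character `∑_{T ∈ S} β^{excess T} x^{wt T}` of a set of tableaux. -/
def charSet (n : ℕ) (lam : ℕ → ℕ) (S : Set Filling) : KPoly :=
  ∑ᶠ t ∈ S, betaP ^ excess n lam t * xwt n lam t

/-- The symmetric Grothendieck polynomial `𝔊_λ(x₁,…,xₙ; β)`. -/
def Groth (n : ℕ) (lam : ℕ → ℕ) : KPoly :=
  charSet n lam {t | IsSVT n lam t}

/-- The Schur polynomial `s_μ(x₁,…,xₙ)`. -/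
def SchurP (n : ℕ) (mu : ℕ → ℕ) : KPoly :=
  ∑ᶠ t ∈ {t : Filling | IsSSYT n mu t}, xwt n mu t

/-- The numerator defining the Demazure–Lascoux operator `ϖ_i`. -/
def DLnum (i : ℕ) (f : KPoly) : KPoly :=
  (MvPolynomial.X i + betaP * MvPolynomial.X i * MvPolynomial.X (i + 1)) * f -
    (MvPolynomial.X (i + 1) + betaP * MvPolynomial.X i * MvPolynomial.X (i + 1)) *
      (MvPolynomial.rename (Equiv.swap i (i + 1)) f)

/-- `DL` implements the Demazure–Lascoux operators `ϖ_i` for `1 ≤ i < n`: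
`(x_i - x_{i+1}) · ϖ_i f` equals the defining numerator. -/
def IsDLOp (n : ℕ) (DL : ℕ → KPoly → KPoly) : Prop :=
  ∀ i, 1 ≤ i → i < n → ∀ f : KPoly,
    (MvPolynomial.X i - MvPolynomial.X (i + 1)) * DL i f = DLnum i f

/-- `applyDL DL [i₁,…,iℓ] f = ϖ_{i₁} ϖ_{i₂} ⋯ ϖ_{iℓ} f`. -/
def applyDL (DL : ℕ → KPoly → KPoly) : List ℕ → KPoly → KPoly
  | [], f => f
  | i :: rest, f => DL i (applyDL DL rest f)

/-- The size `|μ| = μ₁ + ⋯ + μₙ` of a partition with at most `n` parts. -/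
def sizeOfShape (n : ℕ) (mu : ℕ → ℕ) : ℕ := ∑ r ∈ Finset.range n, mu r

/-- The multiplicity `M_λ^μ`: the number of Yamanouchi set-valued tableaux of shape `λ`
and weight `μ`. -/
def Mcoef (n : ℕ) (lam mu : ℕ → ℕ) : ℕ :=
  Nat.card {t : Filling // IsSVT n lam t ∧ IsYamanouchi n lam t ∧
    ∀ r, wt n lam t (r + 1) = mu r}

/-! ### Tableau order conditions at a distance -/

section Order

variable {n : ℕ} {lam : ℕ → ℕ} {t : Filling}

lemma IsPartitionShape.antitone (hlam : IsPartitionShape n lam) : Antitone lam :=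
  antitone_nat_of_succ_le hlam.1

lemma IsSVT.lt_of_mem (ht : IsSVT n lam t) {r c a : ℕ} (ha : a ∈ t r c) : c < lam r := by
  by_contra h
  simp [ht.emptyOutside r c h] at ha

lemma IsSVT.row_lt_of_mem (hlam : IsPartitionShape n lam) (ht : IsSVT n lam t) {r c a : ℕ}
    (ha : a ∈ t r c) : r < n := by
  by_contra h
  have := ht.lt_of_mem ha
  rw [hlam.2 r (not_lt.mp h)] at this
  omega

lemma IsSVT.col_lt_of_mem (hlam : IsPartitionShape n lam) (ht : IsSVT n lam t) {r c a : ℕ}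
    (ha : a ∈ t r c) : c < lam 0 :=
  (ht.lt_of_mem ha).trans_le (hlam.antitone (Nat.zero_le r))

lemma IsSVT.exists_mem (hlam : IsPartitionShape n lam) (ht : IsSVT n lam t) {r c r' c' a : ℕ}
    (ha : a ∈ t r c) (hr : r' ≤ r) (hc : c' ≤ c) : ∃ b, b ∈ t r' c' :=
  ht.boxNonempty r' c' (hc.trans_lt ((ht.lt_of_mem ha).trans_le (hlam.antitone hr)))

lemma IsSVT.row_le (hlam : IsPartitionShape n lam) (ht : IsSVT n lam t) {r c c' a b : ℕ}
    (hcc : c < c') (ha : a ∈ t r c) (hb : b ∈ t r c') : a ≤ b := by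
  induction c', hcc using Nat.le_induction generalizing b with
  | base => exact ht.rowWeak r c a b ha hb
  | succ k hk ih =>
    obtain ⟨e, he⟩ := ht.exists_mem hlam hb le_rfl (Nat.le_succ k)
    exact (ih he).trans (ht.rowWeak r k e b he hb)

lemma IsSVT.col_lt (hlam : IsPartitionShape n lam) (ht : IsSVT n lam t) {r r' c a b : ℕ}
    (hrr : r < r') (ha : a ∈ t r c) (hb : b ∈ t r' c) : a < b := by
  induction r', hrr using Nat.le_induction generalizing b with
  | base => exact ht.colStrict r c a b ha hb
  | succ k hk ih =>
    obtain ⟨e, he⟩ := ht.exists_mem hlam hb (Nat.le_succ k) le_rfl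
    exact (ih he).trans (ht.colStrict k c e b he hb)

lemma IsSVT.row_unique (hlam : IsPartitionShape n lam) (ht : IsSVT n lam t) {r r' c a : ℕ}
    (ha : a ∈ t r c) (hb : a ∈ t r' c) : r = r' := by
  rcases lt_trichotomy r r' with h | h | h
  · exact absurd (ht.col_lt hlam h ha hb) (lt_irrefl a)
  · exact h
  · exact absurd (ht.col_lt hlam h hb ha) (lt_irrefl a)

end Order

/-! ### A Bender–Knuth involution on the first columns of a set-valued tableau -/

/-- Among the first `c` columns, the box `(r, x)` contains `i` or `i + 1` and no other box of
its column does. -/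
def IsFree (i c : ℕ) (t : Filling) (r x : ℕ) : Prop :=
  x < c ∧ (i ∈ t r x ∨ i + 1 ∈ t r x) ∧ ∀ s, s ≠ r → i ∉ t s x ∧ i + 1 ∉ t s x

/-- Reflection of the column `x` in the interval spanned by the free boxes of row `r`. -/
def freeRev (i c : ℕ) (t : Filling) (r x : ℕ) : ℕ :=
  sInf {y | IsFree i c t r y} + sSup {y | IsFree i c t r y} - x

/-- The Bender–Knuth involution: in every row, reverse the run of free boxes among the first
`c` columns and exchange the entries `i` and `i + 1` in it. -/
def bk (i c : ℕ) (t : Filling) : Filling := fun r x =>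
  if IsFree i c t r x then
    ((t r x).erase i).erase (i + 1) ∪
      ((if i + 1 ∈ t r (freeRev i c t r x) then {i} else ∅) ∪
        (if i ∈ t r (freeRev i c t r x) then {i + 1} else ∅))
  else t r x

section BenderKnuth

variable {n i c : ℕ} {lam : ℕ → ℕ} {t : Filling}

lemma bk_of_not_isFree {r x : ℕ} (h : ¬ IsFree i c t r x) : bk i c t r x = t r x := if_neg h

lemma mem_bk_of_isFree {r x a : ℕ} (h : IsFree i c t r x) :
    a ∈ bk i c t r x ↔ (a ≠ i ∧ a ≠ i + 1 ∧ a ∈ t r x) ∨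
      (a = i ∧ i + 1 ∈ t r (freeRev i c t r x)) ∨
      (a = i + 1 ∧ i ∈ t r (freeRev i c t r x)) := by
  rw [bk, if_pos h]
  split_ifs <;> simp_all <;> tauto

lemma left_mem_bk {r x : ℕ} (h : IsFree i c t r x) :
    i ∈ bk i c t r x ↔ i + 1 ∈ t r (freeRev i c t r x) := by
  rw [mem_bk_of_isFree h]; simp

lemma right_mem_bk {r x : ℕ} (h : IsFree i c t r x) :
    i + 1 ∈ bk i c t r x ↔ i ∈ t r (freeRev i c t r x) := by
  rw [mem_bk_of_isFree h]; simp

lemma mem_bk_of_ne {r x a : ℕ} (h1 : a ≠ i) (h2 : a ≠ i + 1) :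
    a ∈ bk i c t r x ↔ a ∈ t r x := by
  by_cases h : IsFree i c t r x
  · rw [mem_bk_of_isFree h]; tauto
  · rw [bk_of_not_isFree h]

lemma bk_of_le {r x : ℕ} (h : c ≤ x) : bk i c t r x = t r x :=
  bk_of_not_isFree fun hf => absurd hf.1 (not_lt.mpr h)

lemma IsFree.exists_mem {r x : ℕ} (h : IsFree i c t r x) :
    ∃ a ∈ t r x, a = i ∨ a = i + 1 := by
  rcases h.2.1 with h | h
  exacts [⟨i, h, Or.inl rfl⟩, ⟨i + 1, h, Or.inr rfl⟩]

lemma IsSVT.isFree_of_between (hlam : IsPartitionShape n lam) (ht : IsSVT n lam t)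
    {r x y z : ℕ} (hx : IsFree i c t r x) (hz : IsFree i c t r z) (hxy : x ≤ y) (hyz : y ≤ z) :
    IsFree i c t r y := by
  rcases hxy.eq_or_lt with rfl | hxy
  · exact hx
  rcases hyz.eq_or_lt with rfl | hyz
  · exact hz
  obtain ⟨a, ha, hai⟩ := hx.exists_mem
  obtain ⟨b, hb, hbi⟩ := hz.exists_mem
  obtain ⟨e, he⟩ := ht.exists_mem hlam hb le_rfl hyz.le
  have h1 := ht.row_le hlam hxy ha he
  have h2 := ht.row_le hlam hyz he hb
  have hei : e = i ∨ e = i + 1 := by omega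
  refine ⟨hyz.trans hz.1, by rcases hei with rfl | rfl <;> tauto, ?_⟩
  suffices H : ∀ r', r' ≠ r → ∀ f ∈ t r' y, f ≠ i ∧ f ≠ i + 1 from
    fun r' hr' => ⟨fun h => (H r' hr' i h).1 rfl, fun h => (H r' hr' _ h).2 rfl⟩
  intro r' hr' f hf
  rcases lt_or_gt_of_ne hr' with hlt | hlt
  · have h3 := ht.col_lt hlam hlt hf he
    obtain ⟨g, hg⟩ := ht.exists_mem hlam hb hlt.le le_rfl
    have h4 := ht.row_le hlam hyz hf hg
    have h5 := ht.col_lt hlam hlt hg hb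
    have h6 := hz.2.2 r' hr'
    have h7 : g ≠ i := by rintro rfl; exact h6.1 hg
    omega
  · have h3 := ht.col_lt hlam hlt he hf
    obtain ⟨g, hg⟩ := ht.exists_mem hlam hf le_rfl hxy.le
    have h4 := ht.row_le hlam hxy hg hf
    have h5 := ht.col_lt hlam hlt ha hg
    have h6 := hx.2.2 r' hr'
    have h7 : g ≠ i + 1 := by rintro rfl; exact h6.2 hg
    omega

lemma IsFree.bounds {r x : ℕ} (h : IsFree i c t r x) :
    sInf {y | IsFree i c t r y} ≤ x ∧ x ≤ sSup {y | IsFree i c t r y} :=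
  ⟨Nat.sInf_le h, le_csSup ⟨c, fun _ hy => hy.1.le⟩ h⟩

lemma IsSVT.isFree_freeRev (hlam : IsPartitionShape n lam) (ht : IsSVT n lam t) {r x : ℕ}
    (h : IsFree i c t r x) : IsFree i c t r (freeRev i c t r x) := by
  have hne : {y | IsFree i c t r y}.Nonempty := ⟨x, h⟩
  have h1 := Nat.sInf_mem hne
  have h2 := Nat.sSup_mem hne ⟨c, fun _ hy => hy.1.le⟩
  have h3 := h.bounds
  exact ht.isFree_of_between hlam h1 h2 (by unfold freeRev; omega) (by unfold freeRev; omega)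

lemma IsFree.freeRev_freeRev {r x : ℕ} (h : IsFree i c t r x) :
    freeRev i c t r (freeRev i c t r x) = x := by
  have := h.bounds
  unfold freeRev
  omega

lemma IsSVT.isFree_bk (hlam : IsPartitionShape n lam) (ht : IsSVT n lam t) (r x : ℕ) :
    IsFree i c (bk i c t) r x ↔ IsFree i c t r x := by
  constructor
  · intro h
    by_contra hf
    obtain ⟨h1, h2, h3⟩ := h
    rw [bk_of_not_isFree hf] at h2
    refine hf ⟨h1, h2, fun r' hr' => ?_⟩
    have h4 := h3 r' hr'
    rwa [bk_of_not_isFree fun h' => by have := h'.2.2 r hr'.symm; tauto] at h4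
  · intro h
    refine ⟨h.1, ?_, fun r' hr' => ?_⟩
    · rw [left_mem_bk h, right_mem_bk h]
      exact (ht.isFree_freeRev hlam h).2.1.symm
    · have h4 := h.2.2 r' hr'
      rwa [bk_of_not_isFree fun h' => by have := h'.2.1; tauto]

lemma IsSVT.freeRev_bk (hlam : IsPartitionShape n lam) (ht : IsSVT n lam t) (r x : ℕ) :
    freeRev i c (bk i c t) r x = freeRev i c t r x := by
  simp only [freeRev, ht.isFree_bk hlam]

lemma IsSVT.bk_bk (hlam : IsPartitionShape n lam) (ht : IsSVT n lam t) :
    bk i c (bk i c t) = t := by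
  funext r x
  by_cases h : IsFree i c t r x
  · have h' := (ht.isFree_bk hlam r x).2 h
    have hr := ht.isFree_freeRev hlam h
    ext a
    by_cases h1 : a = i
    · subst h1
      rw [left_mem_bk h', ht.freeRev_bk hlam, right_mem_bk hr, h.freeRev_freeRev]
    by_cases h2 : a = i + 1
    · subst h2
      rw [right_mem_bk h', ht.freeRev_bk hlam, left_mem_bk hr, h.freeRev_freeRev]
    rw [mem_bk_of_ne h1 h2, mem_bk_of_ne h1 h2]
  · rw [bk_of_not_isFree (mt (ht.isFree_bk hlam r x).1 h), bk_of_not_isFree h]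

lemma IsSVT.rowWeak_bk (hlam : IsPartitionShape n lam) (ht : IsSVT n lam t)
    (hc : ∀ r, i ∉ t r c) {r x a b : ℕ} (ha : a ∈ bk i c t r x) (hb : b ∈ bk i c t r (x + 1)) :
    a ≤ b := by
  by_cases hx : IsFree i c t r x <;> by_cases hy : IsFree i c t r (x + 1)
  · obtain ⟨e, he, hei⟩ := hx.exists_mem
    obtain ⟨f, hf, hfi⟩ := hy.exists_mem
    have hlt : freeRev i c t r (x + 1) < freeRev i c t r x := by
      have := hx.bounds
      have := hy.bounds
      unfold freeRev
      omega
    rcases (mem_bk_of_isFree hx).1 ha with ⟨h1, h2, h3⟩ | ⟨h1, h2⟩ | ⟨h1, h2⟩ <;>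
    rcases (mem_bk_of_isFree hy).1 hb with ⟨k1, k2, k3⟩ | ⟨k1, k2⟩ | ⟨k1, k2⟩
    · exact ht.rowWeak r x a b h3 k3
    · have := ht.rowWeak r x a f h3 hf; omega
    · have := ht.rowWeak r x a f h3 hf; omega
    · have := ht.rowWeak r x e b he k3; omega
    · omega
    · omega
    · have := ht.rowWeak r x e b he k3; omega
    · have := ht.row_le hlam hlt k2 h2; omega
    · omega
  · rw [bk_of_not_isFree hy] at hb
    obtain ⟨e, he, hei⟩ := hx.exists_mem
    have heb := ht.rowWeak r x e b he hb
    rcases (mem_bk_of_isFree hx).1 ha with ⟨h1, h2, h3⟩ | ⟨h1, h2⟩ | ⟨h1, h2⟩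
    · exact ht.rowWeak r x a b h3 hb
    · omega
    · by_contra hlt
      obtain rfl : b = i := by omega
      have hxc : x + 1 < c := by
        rcases Nat.lt_or_ge (x + 1) c with h | h
        · exact h
        · have := hx.1
          obtain rfl : x + 1 = c := by omega
          exact absurd hb (hc r)
      refine hy ⟨hxc, Or.inl hb, fun r' hr' => ?_⟩
      refine ⟨fun h => hr' (ht.row_unique hlam h hb), fun h => ?_⟩
      rcases lt_or_gt_of_ne hr' with hlt | hlt
      · have := ht.col_lt hlam hlt h hb; omega
      · obtain ⟨g, hg⟩ := ht.exists_mem hlam h le_rfl (Nat.le_succ x)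
        have h4 := ht.rowWeak r' x g _ hg h
        have h5 := ht.col_lt hlam hlt he hg
        obtain rfl : g = b + 1 := by omega
        exact (hx.2.2 r' hr').2 hg
  · rw [bk_of_not_isFree hx] at ha
    obtain ⟨f, hf, hfi⟩ := hy.exists_mem
    have haf := ht.rowWeak r x a f ha hf
    rcases (mem_bk_of_isFree hy).1 hb with ⟨k1, k2, k3⟩ | ⟨k1, k2⟩ | ⟨k1, k2⟩
    · exact ht.rowWeak r x a b ha k3
    · by_contra hlt
      obtain rfl : a = i + 1 := by omega
      have hxc := hy.1
      refine hx ⟨by omega, Or.inr ha, fun r' hr' => ?_⟩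
      refine ⟨fun h => ?_, fun h => hr' (ht.row_unique hlam h ha)⟩
      rcases lt_or_gt_of_ne hr' with hlt | hlt
      · obtain ⟨g, hg⟩ := ht.exists_mem hlam hf hlt.le le_rfl
        have h4 := ht.rowWeak r' x i g h hg
        have h5 := ht.col_lt hlam hlt hg hf
        obtain rfl : g = i := by omega
        exact (hy.2.2 r' hr').1 hg
      · have := ht.col_lt hlam hlt ha h; omega
    · omega
  · rw [bk_of_not_isFree hx] at ha
    rw [bk_of_not_isFree hy] at hb
    exact ht.rowWeak r x a b ha hb

lemma IsSVT.colStrict_bk (ht : IsSVT n lam t) {r x a b : ℕ} (ha : a ∈ bk i c t r x)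
    (hb : b ∈ bk i c t (r + 1) x) : a < b := by
  by_cases hx : IsFree i c t r x <;> by_cases hy : IsFree i c t (r + 1) x
  · have h1 := hx.2.2 (r + 1) (by omega)
    have h2 := hy.2.1
    tauto
  · rw [bk_of_not_isFree hy] at hb
    obtain ⟨e, he, hei⟩ := hx.exists_mem
    have heb := ht.colStrict r x e b he hb
    have h1 := hx.2.2 (r + 1) (by omega)
    have h2 : b ≠ i + 1 := by rintro rfl; exact h1.2 hb
    rcases (mem_bk_of_isFree hx).1 ha with ⟨-, -, h3⟩ | ⟨h3, -⟩ | ⟨h3, -⟩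
    · exact ht.colStrict r x a b h3 hb
    · omega
    · omega
  · rw [bk_of_not_isFree hx] at ha
    obtain ⟨e, he, hei⟩ := hy.exists_mem
    have hae := ht.colStrict r x a e ha he
    have h1 := hy.2.2 r (by omega)
    have h2 : a ≠ i := by rintro rfl; exact h1.1 ha
    rcases (mem_bk_of_isFree hy).1 hb with ⟨-, -, h3⟩ | ⟨h3, -⟩ | ⟨h3, -⟩
    · exact ht.colStrict r x a b ha h3
    · omega
    · omega
  · rw [bk_of_not_isFree hx] at ha
    rw [bk_of_not_isFree hy] at hb
    exact ht.colStrict r x a b ha hb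

lemma IsSVT.bk (hlam : IsPartitionShape n lam) (ht : IsSVT n lam t) (hi : 1 ≤ i) (hin : i < n)
    (hc : ∀ r, i ∉ t r c) : IsSVT n lam (bk i c t) where
  boxNonempty r x hx := by
    by_cases h : IsFree i c t r x
    · rcases ((ht.isFree_bk hlam r x).2 h).2.1 with h | h
      exacts [⟨_, h⟩, ⟨_, h⟩]
    · rw [bk_of_not_isFree h]; exact ht.boxNonempty r x hx
  emptyOutside r x hx := by
    have h : ¬ IsFree i c t r x := fun h => by
      rcases h.2.1 with h | h
      exacts [hx (ht.lt_of_mem h), hx (ht.lt_of_mem h)]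
    rw [bk_of_not_isFree h]; exact ht.emptyOutside r x hx
  entryBounds r x a ha := by
    by_cases h1 : a = i
    · omega
    by_cases h2 : a = i + 1
    · omega
    exact ht.entryBounds r x a ((mem_bk_of_ne h1 h2).1 ha)
  rowWeak _ _ _ _ ha hb := ht.rowWeak_bk hlam hc ha hb
  colStrict _ _ _ _ ha hb := ht.colStrict_bk ha hb

end BenderKnuth

/-! ### Counting entries column by column -/

/-- The number of boxes containing `j` in the columns belonging to `s`. -/
def colCount (n : ℕ) (t : Filling) (j : ℕ) (s : Finset ℕ) : ℕ :=
  ((Finset.range n ×ˢ s).filter (fun p => j ∈ t p.1 p.2)).card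

section Counting

variable {n i c : ℕ} {lam : ℕ → ℕ} {t : Filling}

lemma wt_eq_colCount (n : ℕ) (lam : ℕ → ℕ) (t : Filling) (j : ℕ) :
    wt n lam t j = colCount n t j (Finset.range (lam 0)) := rfl

lemma colCount_congr {t' : Filling} {j j' : ℕ} {s : Finset ℕ}
    (h : ∀ r, ∀ x ∈ s, j ∈ t r x ↔ j' ∈ t' r x) : colCount n t j s = colCount n t' j' s := by
  unfold colCount
  congr 1
  refine Finset.filter_congr fun p hp => h _ _ (Finset.mem_product.1 hp).2

lemma colCount_union {j : ℕ} {s s' : Finset ℕ} (h : Disjoint s s') :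
    colCount n t j (s ∪ s') = colCount n t j s + colCount n t j s' := by
  unfold colCount
  rw [Finset.product_union, Finset.filter_union, Finset.card_union_of_disjoint]
  exact Finset.disjoint_filter_filter (Finset.disjoint_product.2 (Or.inr h))

lemma colCount_range_add_Ico {j m : ℕ} (h : c ≤ m) :
    colCount n t j (Finset.range c) + colCount n t j (Finset.Ico c m) =
      colCount n t j (Finset.range m) := by
  simp only [Finset.range_eq_Ico]
  rw [← Finset.Ico_union_Ico_eq_Ico (Nat.zero_le c) h, colCount_union]
  exact Finset.Ico_disjoint_Ico_consecutive 0 c m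

lemma IsSVT.colCount_singleton (hlam : IsPartitionShape n lam) (ht : IsSVT n lam t) (j x : ℕ) :
    colCount n t j {x} = if colHas n t j x then 1 else 0 := by
  unfold colCount
  split_ifs with h
  · obtain ⟨r, hr, hj⟩ := h
    rw [Finset.card_eq_one]
    refine ⟨(r, x), ?_⟩
    ext ⟨r', x'⟩
    simp only [Finset.mem_filter, Finset.mem_product, Finset.mem_range, Finset.mem_singleton,
      Prod.mk.injEq]
    constructor
    · rintro ⟨⟨_, rfl⟩, h⟩
      exact ⟨ht.row_unique hlam h hj, rfl⟩
    · rintro ⟨rfl, rfl⟩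
      exact ⟨⟨hr, rfl⟩, hj⟩
  · rw [Finset.card_eq_zero, Finset.filter_eq_empty_iff]
    rintro ⟨r', x'⟩ hp hj
    simp only [Finset.mem_product, Finset.mem_range, Finset.mem_singleton] at hp
    obtain ⟨hr, rfl⟩ := hp
    exact h ⟨r', hr, hj⟩

lemma IsSVT.colCount_Ico_succ (hlam : IsPartitionShape n lam) (ht : IsSVT n lam t) {j m : ℕ}
    (h : c < m) : colCount n t j (Finset.Ico c m) =
      (if colHas n t j c then 1 else 0) + colCount n t j (Finset.Ico (c + 1) m) := by
  rw [← ht.colCount_singleton hlam, ← colCount_union (by simp)]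
  congr 1
  ext y
  simp only [Finset.mem_Ico, Finset.mem_union, Finset.mem_singleton]
  omega

lemma colCount_Ico_of_le {j m : ℕ} (h : m ≤ c) : colCount n t j (Finset.Ico c m) = 0 := by
  simp [colCount, Finset.Ico_eq_empty_of_le h]

lemma IsSVT.succ_mem_below (hlam : IsPartitionShape n lam) (ht : IsSVT n lam t) {r x : ℕ}
    (hx : x < c) (hi : i ∈ t r x) (hf : ¬ IsFree i c t r x) : i + 1 ∈ t (r + 1) x := by
  by_contra h
  refine hf ⟨hx, Or.inl hi, fun r' hr' => ⟨fun h' => hr' (ht.row_unique hlam h' hi), fun h' => ?_⟩⟩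
  rcases lt_trichotomy r' (r + 1) with hlt | rfl | hlt
  · have := ht.col_lt hlam (show r' < r by omega) h' hi
    omega
  · exact h h'
  · obtain ⟨e, he⟩ := ht.exists_mem hlam h' hlt.le le_rfl
    have := ht.col_lt hlam hlt he h'
    have := ht.colStrict r x i e hi he
    omega

lemma IsSVT.mem_above (hlam : IsPartitionShape n lam) (ht : IsSVT n lam t) {r x : ℕ}
    (hx : x < c) (hi : i + 1 ∈ t r x) (hf : ¬ IsFree i c t r x) :
    0 < r ∧ i ∈ t (r - 1) x := by
  by_contra h
  refine hf ⟨hx, Or.inr hi, fun r' hr' => ⟨fun h' => ?_, fun h' => hr' (ht.row_unique hlam h' hi)⟩⟩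
  rcases lt_or_gt_of_ne hr' with hlt | hlt
  · rcases (show r' ≤ r - 1 by omega).eq_or_lt with rfl | hlt'
    · exact h ⟨by omega, h'⟩
    · obtain ⟨e, he⟩ := ht.exists_mem hlam hi (Nat.sub_le r 1) le_rfl
      have h1 := ht.col_lt hlam hlt' h' he
      have h2 := ht.col_lt hlam (show r - 1 < r by omega) he hi
      omega
  · have := ht.col_lt hlam hlt hi h'
    omega

lemma IsSVT.colCount_bk_left (hlam : IsPartitionShape n lam) (ht : IsSVT n lam t) :
    colCount n (SVTCrystal.bk i c t) i (Finset.range c) =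
      colCount n t (i + 1) (Finset.range c) := by
  unfold colCount
  refine Finset.card_nbij'
    (fun p => if IsFree i c t p.1 p.2 then (p.1, freeRev i c t p.1 p.2) else (p.1 + 1, p.2))
    (fun p => if IsFree i c t p.1 p.2 then (p.1, freeRev i c t p.1 p.2) else (p.1 - 1, p.2))
    ?_ ?_ ?_ ?_
  · rintro ⟨r, x⟩ hp
    simp only [Finset.coe_filter, Finset.mem_product, Finset.mem_range, Set.mem_ofPred_eq] at hp ⊢
    split_ifs with hf
    · exact ⟨⟨hp.1.1, (ht.isFree_freeRev hlam hf).1⟩, (left_mem_bk hf).1 hp.2⟩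
    · rw [bk_of_not_isFree hf] at hp
      have := ht.succ_mem_below hlam hp.1.2 hp.2 hf
      exact ⟨⟨ht.row_lt_of_mem hlam this, hp.1.2⟩, this⟩
  · rintro ⟨r, x⟩ hp
    simp only [Finset.coe_filter, Finset.mem_product, Finset.mem_range, Set.mem_ofPred_eq] at hp ⊢
    split_ifs with hf
    · refine ⟨⟨hp.1.1, (ht.isFree_freeRev hlam hf).1⟩, ?_⟩
      rw [left_mem_bk (ht.isFree_freeRev hlam hf), hf.freeRev_freeRev]
      exact hp.2
    · have := ht.mem_above hlam hp.1.2 hp.2 hf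
      refine ⟨⟨by omega, hp.1.2⟩, ?_⟩
      rw [bk_of_not_isFree]
      · exact this.2
      · exact fun h => (h.2.2 r (by omega)).2 hp.2
  · rintro ⟨r, x⟩ hp
    simp only [Finset.coe_filter, Finset.mem_product, Finset.mem_range, Set.mem_ofPred_eq] at hp ⊢
    by_cases hf : IsFree i c t r x
    · simp [hf, ht.isFree_freeRev hlam hf, hf.freeRev_freeRev]
    · rw [bk_of_not_isFree hf] at hp
      have h : ¬ IsFree i c t (r + 1) x := fun h => (h.2.2 r (by omega)).1 hp.2
      simp [hf, h]
  · rintro ⟨r, x⟩ hp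
    simp only [Finset.coe_filter, Finset.mem_product, Finset.mem_range, Set.mem_ofPred_eq] at hp ⊢
    by_cases hf : IsFree i c t r x
    · simp [hf, ht.isFree_freeRev hlam hf, hf.freeRev_freeRev]
    · have := ht.mem_above hlam hp.1.2 hp.2 hf
      have h : ¬ IsFree i c t (r - 1) x := fun h => (h.2.2 r (by omega)).2 hp.2
      simp only [hf, h, if_false, Prod.mk.injEq, and_true]
      omega

lemma IsSVT.colCount_bk_right (hlam : IsPartitionShape n lam) (ht : IsSVT n lam t)
    (ht' : IsSVT n lam (SVTCrystal.bk i c t)) :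
    colCount n (SVTCrystal.bk i c t) (i + 1) (Finset.range c) =
      colCount n t i (Finset.range c) := by
  rw [← ht'.colCount_bk_left hlam, ht.bk_bk hlam]

lemma colCount_bk_of_ne {j : ℕ} {s : Finset ℕ} (h1 : j ≠ i) (h2 : j ≠ i + 1) :
    colCount n (bk i c t) j s = colCount n t j s :=
  colCount_congr fun _ _ _ => mem_bk_of_ne h1 h2

lemma colCount_bk_Ico {j c' m : ℕ} (h : c ≤ c') :
    colCount n (bk i c t) j (Finset.Ico c' m) = colCount n t j (Finset.Ico c' m) :=
  colCount_congr fun _ _ hx => by rw [bk_of_le (h.trans (Finset.mem_Ico.1 hx).1)]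

/-- The total number of entries is the number of boxes plus the excess. -/
lemma IsSVT.sum_wt (hlam : IsPartitionShape n lam) (ht : IsSVT n lam t) :
    ∑ j ∈ Finset.Icc 1 n, wt n lam t j = excess n lam t + sizeOfShape n lam := by
  have h1 : ∑ j ∈ Finset.Icc 1 n, wt n lam t j =
      ∑ p ∈ Finset.range n ×ˢ Finset.range (lam 0), (t p.1 p.2).card := by
    simp only [wt, Finset.card_filter]
    rw [Finset.sum_comm]
    refine Finset.sum_congr rfl fun p _ => ?_
    rw [← Finset.card_filter]
    congr 1
    ext a
    simp only [Finset.mem_filter, Finset.mem_Icc, and_iff_right_iff_imp]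
    exact ht.entryBounds p.1 p.2 a
  have h2 : sizeOfShape n lam =
      ∑ p ∈ Finset.range n ×ˢ Finset.range (lam 0), if p.2 < lam p.1 then 1 else 0 := by
    rw [Finset.sum_product, sizeOfShape]
    refine Finset.sum_congr rfl fun r _ => ?_
    rw [← Finset.card_filter]
    have : (Finset.range (lam 0)).filter (fun x => x < lam r) = Finset.range (lam r) := by
      ext x
      have := hlam.antitone (Nat.zero_le r)
      simp only [Finset.mem_filter, Finset.mem_range]
      omega
    rw [this, Finset.card_range]
  rw [h1, h2, excess, ← Finset.sum_add_distrib]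
  refine Finset.sum_congr rfl fun p _ => ?_
  split_ifs with h
  · have := (ht.boxNonempty p.1 p.2 h).card_pos
    omega
  · simp [ht.emptyOutside p.1 p.2 h]

lemma IsSVT.wt_bk_add (hlam : IsPartitionShape n lam) (ht : IsSVT n lam t)
    (ht' : IsSVT n lam (SVTCrystal.bk i c t)) (hc : c ≤ lam 0) (j : ℕ) :
    wt n lam (SVTCrystal.bk i c t) j =
      colCount n t (Equiv.swap i (i + 1) j) (Finset.range c) +
        colCount n t j (Finset.Ico c (lam 0)) := by
  rw [wt_eq_colCount, ← colCount_range_add_Ico hc, colCount_bk_Ico le_rfl]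
  congr 1
  by_cases h1 : j = i
  · subst h1; rw [Equiv.swap_apply_left, ht.colCount_bk_left hlam]
  by_cases h2 : j = i + 1
  · subst h2; rw [Equiv.swap_apply_right, ht.colCount_bk_right hlam ht']
  rw [Equiv.swap_apply_of_ne_of_ne h1 h2, colCount_bk_of_ne h1 h2]

lemma IsSVT.excess_bk (hlam : IsPartitionShape n lam) (ht : IsSVT n lam t)
    (ht' : IsSVT n lam (SVTCrystal.bk i c t)) (hi : 1 ≤ i) (hin : i < n) (hc : c ≤ lam 0) :
    excess n lam (SVTCrystal.bk i c t) = excess n lam t := by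
  have h1 := ht.sum_wt hlam
  have h2 := ht'.sum_wt hlam
  have h3 : ∑ j ∈ Finset.Icc 1 n, wt n lam (SVTCrystal.bk i c t) j =
      ∑ j ∈ Finset.Icc 1 n, wt n lam t j := by
    simp only [ht.wt_bk_add hlam ht' hc, wt_eq_colCount, ← colCount_range_add_Ico hc,
      Finset.sum_add_distrib, add_left_inj]
    refine Finset.sum_equiv (Equiv.swap i (i + 1)) (fun j => ?_) (fun _ _ => rfl)
    by_cases h1 : j = i
    · subst h1; simp only [Equiv.swap_apply_left, Finset.mem_Icc]; omega
    by_cases h2 : j = i + 1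
    · subst h2; simp only [Equiv.swap_apply_right, Finset.mem_Icc]; omega
    rw [Equiv.swap_apply_of_ne_of_ne h1 h2]
  omega

end Counting

/-! ### Yamanouchi tableaux through suffix weights -/

section Yamanouchi

variable {n i : ℕ} {lam : ℕ → ℕ} {t : Filling}

lemma colSign_eq_false_iff {c : ℕ} :
    colSign n t i c = some false ↔ colHas n t (i + 1) c ∧ ¬ colHas n t i c := by
  unfold colSign
  split_ifs <;> simp_all

lemma eRaw_eq_none_iff : eRaw n lam i t = none ↔ ∀ c, ¬ MinusCol n (lam 0) t i c := by
  constructor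
  · intro h c hc
    have hex : ∃ c, eBoxCol n (lam 0) t i c :=
      ⟨sInf {c | MinusCol n (lam 0) t i c},
        Nat.sInf_mem (s := {c | MinusCol n (lam 0) t i c}) ⟨c, hc⟩, fun _ h' => Nat.sInf_le h'⟩
    have hr : ∃ r, r < n ∧ i + 1 ∈ t r (Classical.choose hex) :=
      (colSign_eq_false_iff.1 (Classical.choose_spec hex).1.2.1).1
    rw [eRaw, dif_pos hex] at h
    simp only [dif_pos hr] at h
    split_ifs at h
  · intro h
    rw [eRaw, dif_neg]
    rintro ⟨c, hc⟩
    exact h c hc.1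

/-- The number of uncanceled `+` signs among the columns `≥ c`. -/
def suffixPlus (n m i : ℕ) (t : Filling) (c : ℕ) : ℕ :=
  pctr (((List.range m).drop c).filterMap (colSign n t i))

lemma suffixPlus_of_lt {m c : ℕ} (h : c < m) :
    suffixPlus n m i t c =
      if colHas n t i c ∧ ¬ colHas n t (i + 1) c then suffixPlus n m i t (c + 1) + 1
      else if colHas n t (i + 1) c ∧ ¬ colHas n t i c then suffixPlus n m i t (c + 1) - 1
      else suffixPlus n m i t (c + 1) := by
  unfold suffixPlus
  rw [List.drop_eq_getElem_cons (by simpa using h), List.filterMap_cons, List.getElem_range,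
    colSign]
  split_ifs <;> simp [pctr]

lemma IsSVT.suffixPlus_add (hlam : IsPartitionShape n lam) (ht : IsSVT n lam t) {c : ℕ}
    (hc : c ≤ lam 0) (h : ∀ c', c ≤ c' → ¬ MinusCol n (lam 0) t i c') :
    suffixPlus n (lam 0) i t c + colCount n t (i + 1) (Finset.Ico c (lam 0)) =
      colCount n t i (Finset.Ico c (lam 0)) := by
  induction hc using Nat.decreasingInduction with
  | self => simp [colCount, suffixPlus, pctr, List.drop_eq_nil_of_le]
  | of_succ k hk ih =>
    have ih := ih fun c' hc' => h c' (by omega)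
    rw [suffixPlus_of_lt hk, ht.colCount_Ico_succ hlam hk, ht.colCount_Ico_succ hlam hk]
    have hm : ¬ ((colHas n t (i + 1) k ∧ ¬ colHas n t i k) ∧
        suffixPlus n (lam 0) i t (k + 1) = 0) :=
      fun h' => h k le_rfl ⟨hk, colSign_eq_false_iff.2 h'.1, h'.2⟩
    by_cases h1 : colHas n t i k <;> by_cases h2 : colHas n t (i + 1) k <;>
      simp only [h1, h2, not_true, not_false_iff, and_true, and_false, true_and, false_and,
        if_true, if_false] at hm ⊢ <;> omega

lemma IsSVT.isYamanouchi_iff (hlam : IsPartitionShape n lam) (ht : IsSVT n lam t) :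
    IsYamanouchi n lam t ↔ ∀ i, 1 ≤ i → i < n → ∀ c,
      colCount n t (i + 1) (Finset.Ico c (lam 0)) ≤ colCount n t i (Finset.Ico c (lam 0)) := by
  refine forall_congr' fun i => forall_congr' fun _ => forall_congr' fun _ => ?_
  rw [eRaw_eq_none_iff]
  constructor
  · intro h c
    rcases le_total (lam 0) c with hc | hc
    · rw [colCount_Ico_of_le hc]; exact Nat.zero_le _
    · have := ht.suffixPlus_add hlam hc fun c' _ => h c'
      omega
  · intro h c₀ hc₀
    have hbdd : BddAbove {c | MinusCol n (lam 0) t i c} := ⟨lam 0, fun c hc => hc.1.le⟩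
    obtain ⟨hc, hs, hp⟩ := Nat.sSup_mem ⟨c₀, hc₀⟩ hbdd
    set c := sSup {c | MinusCol n (lam 0) t i c}
    have h1 := ht.suffixPlus_add hlam (show c + 1 ≤ lam 0 from hc) (i := i) fun c' hc' hm => by
      have := le_csSup hbdd hm
      omega
    have h2 := h c
    rw [ht.colCount_Ico_succ hlam hc, ht.colCount_Ico_succ hlam hc] at h2
    have h3 : suffixPlus n (lam 0) i t (c + 1) = 0 := hp
    have h4 := colSign_eq_false_iff.1 hs
    simp only [h4.1, h4.2, if_true, if_false] at h2
    omega

end Yamanouchi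

/-! ### The highest weight semistandard tableau -/

section HighestWeight

variable {n : ℕ} {lam : ℕ → ℕ} {t : Filling}

lemma IsSVT.excess_eq_zero_iff (hlam : IsPartitionShape n lam) (ht : IsSVT n lam t) :
    excess n lam t = 0 ↔ ∀ r c, c < lam r → (t r c).card = 1 := by
  simp only [excess, Finset.sum_eq_zero_iff, Finset.mem_product, Finset.mem_range]
  constructor
  · intro h r c hc
    have h1 := (ht.boxNonempty r c hc).card_pos
    obtain ⟨a, ha⟩ := ht.boxNonempty r c hc
    have := h (r, c) ⟨ht.row_lt_of_mem hlam ha, ht.col_lt_of_mem hlam ha⟩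
    simp only at this
    omega
  · rintro h ⟨r, c⟩ -
    by_cases hc : c < lam r
    · simp [h r c hc]
    · simp [ht.emptyOutside r c hc]

lemma mem_uTab {r c a : ℕ} : a ∈ uTab lam r c ↔ c < lam r ∧ a = r + 1 := by
  unfold uTab
  split_ifs with h <;> simp [h]

lemma isSVT_uTab (hlam : IsPartitionShape n lam) : IsSVT n lam (uTab lam) where
  boxNonempty r c h := by simp [uTab, h]
  emptyOutside r c h := by simp [uTab, h]
  entryBounds r c a ha := by
    obtain ⟨h, rfl⟩ := mem_uTab.1 ha
    have : r < n := by
      by_contra hr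
      rw [hlam.2 r (not_lt.1 hr)] at h
      omega
    omega
  rowWeak r c a b ha hb := by rw [(mem_uTab.1 ha).2, (mem_uTab.1 hb).2]
  colStrict r c a b ha hb := by
    rw [(mem_uTab.1 ha).2, (mem_uTab.1 hb).2]
    exact Nat.lt_succ_self _

lemma excess_uTab (hlam : IsPartitionShape n lam) : excess n lam (uTab lam) = 0 := by
  rw [(isSVT_uTab hlam).excess_eq_zero_iff hlam]
  intro r c h
  simp [uTab, h]

lemma colCount_uTab {k : ℕ} (hk : k < n) (s : Finset ℕ) :
    colCount n (uTab lam) (k + 1) s = (s.filter (· < lam k)).card := by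
  rw [← Finset.card_map ⟨fun x => (k, x), fun x y h => by simpa using h⟩, colCount]
  congr 1
  ext ⟨r, x⟩
  simp only [mem_uTab, Finset.mem_filter, Finset.mem_product, Finset.mem_range, Finset.mem_map]
  constructor
  · rintro ⟨⟨h1, h2⟩, h3, h4⟩
    obtain rfl : k = r := by omega
    exact ⟨x, ⟨h2, h3⟩, rfl⟩
  · rintro ⟨y, ⟨h1, h2⟩, h3⟩
    obtain ⟨rfl, rfl⟩ := Prod.mk.inj h3
    exact ⟨⟨hk, h1⟩, h2, rfl⟩

lemma wt_uTab (hlam : IsPartitionShape n lam) {k : ℕ} (hk : k < n) :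
    wt n lam (uTab lam) (k + 1) = lam k := by
  rw [wt_eq_colCount, colCount_uTab hk]
  have : (Finset.range (lam 0)).filter (· < lam k) = Finset.range (lam k) := by
    ext x
    have := hlam.antitone (Nat.zero_le k)
    simp only [Finset.mem_filter, Finset.mem_range]
    omega
  rw [this, Finset.card_range]

lemma isYamanouchi_uTab (hlam : IsPartitionShape n lam) : IsYamanouchi n lam (uTab lam) := by
  rw [(isSVT_uTab hlam).isYamanouchi_iff hlam]
  intro i hi hin c
  obtain ⟨k, rfl⟩ : ∃ k, i = k + 1 := ⟨i - 1, by omega⟩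
  rw [colCount_uTab hin, colCount_uTab (by omega)]
  refine Finset.card_le_card (Finset.monotone_filter_right _ fun x _ h => ?_)
  exact lt_of_lt_of_le h (hlam.1 k)

/-- A Yamanouchi semistandard tableau has all entries of row `r` equal to `r + 1`. -/
lemma IsSVT.eq_uTab (hlam : IsPartitionShape n lam) (ht : IsSVT n lam t)
    (h1 : ∀ r c, c < lam r → (t r c).card = 1) (hY : IsYamanouchi n lam t) : t = uTab lam := by
  rw [ht.isYamanouchi_iff hlam] at hY
  have key : ∀ r c a, a ∈ t r c → a = r + 1 := by
    intro r
    induction r using Nat.strong_induction_on with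
    | _ r ih =>
    intro c a ha
    have hge : r + 1 ≤ a := by
      rcases Nat.eq_zero_or_pos r with rfl | hr
      · exact (ht.entryBounds _ _ _ ha).1
      · obtain ⟨b, hb⟩ := ht.exists_mem hlam ha (Nat.sub_le r 1) le_rfl
        have := ih (r - 1) (by omega) c b hb
        have := ht.col_lt hlam (show r - 1 < r by omega) hb ha
        omega
    have hc := ht.lt_of_mem ha
    obtain ⟨v, hv⟩ := ht.boxNonempty r (lam r - 1) (by omega)
    have hav : a ≤ v := by
      rcases (show c ≤ lam r - 1 by omega).eq_or_lt with h | h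
      · rw [← h] at hv
        exact (Finset.card_le_one.1 (h1 r c hc).le a ha v hv).le
      · exact ht.row_le hlam h ha hv
    by_contra hne
    obtain ⟨i, rfl⟩ : ∃ i, v = i + 1 := ⟨v - 1, by omega⟩
    have hvn := ht.entryBounds _ _ _ hv
    have hpos : 0 < colCount n t (i + 1) (Finset.Ico (lam r - 1) (lam 0)) := by
      refine Finset.card_pos.2 ⟨(r, lam r - 1), ?_⟩
      have h2 := ht.row_lt_of_mem hlam hv
      have h3 := ht.col_lt_of_mem hlam hv
      simp [hv, h2, h3]
    obtain ⟨⟨r', c'⟩, hp⟩ := Finset.card_pos.1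
      (hpos.trans_le (hY i (by omega) (by omega) (lam r - 1)))
    simp only [Finset.mem_filter, Finset.mem_product, Finset.mem_range, Finset.mem_Ico] at hp
    obtain ⟨⟨-, hc', -⟩, hi⟩ := hp
    have hc'' := ht.lt_of_mem hi
    rcases lt_trichotomy r' r with h | rfl | h
    · have := ih r' h c' i hi
      omega
    · obtain rfl : c' = lam r' - 1 := by omega
      have := Finset.card_le_one.1 (h1 _ _ hc'').le i hi _ hv
      omega
    · have := hlam.antitone h.le
      obtain rfl : c' = lam r - 1 := by omega
      have := ht.col_lt hlam h hv hi
      omega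
  funext r c
  by_cases h : c < lam r
  · obtain ⟨a, ha⟩ := Finset.card_eq_one.1 (h1 r c h)
    have := key r c a (by simp [ha])
    simp [uTab, h, ha, this]
  · simp [uTab, h, ht.emptyOutside r c h]

lemma finite_isSVT (hlam : IsPartitionShape n lam) : {t | IsSVT n lam t}.Finite := by
  let f : Filling → (Fin n × Fin (lam 0) → (Finset.Icc 1 n).powerset) := fun t p =>
    ⟨t p.1 p.2 ∩ Finset.Icc 1 n, Finset.mem_powerset.2 Finset.inter_subset_right⟩
  refine Set.Finite.of_injOn (f := f) (t := Set.univ) (fun _ _ => trivial) ?_ Set.finite_univ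
  intro t ht t' ht' h
  have hsub : ∀ {t : Filling}, IsSVT n lam t → ∀ r c, t r c ∩ Finset.Icc 1 n = t r c :=
    fun ht r c => Finset.inter_eq_left.2 fun a ha => Finset.mem_Icc.2 (ht.entryBounds r c a ha)
  funext r c
  by_cases hc : c < lam r
  · obtain ⟨a, ha⟩ := IsSVT.boxNonempty ht r c hc
    have h1 := congrArg Subtype.val (congrFun h
      (⟨r, IsSVT.row_lt_of_mem hlam ht ha⟩, ⟨c, IsSVT.col_lt_of_mem hlam ht ha⟩))
    simpa only [f, hsub ht, hsub ht'] using h1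
  · rw [IsSVT.emptyOutside ht r c hc, IsSVT.emptyOutside ht' r c hc]

end HighestWeight

/-! ### The sign-reversing involution -/

/-- Among the columns `≥ c` there are more entries `i + 1` than entries `i`. -/
def Defect (n : ℕ) (lam : ℕ → ℕ) (t : Filling) (c i : ℕ) : Prop :=
  1 ≤ i ∧ i < n ∧
    colCount n t i (Finset.Ico c (lam 0)) < colCount n t (i + 1) (Finset.Ico c (lam 0))

/-- The rightmost column at which the suffix weight fails to be a partition. -/
def defectCol (n : ℕ) (lam : ℕ → ℕ) (t : Filling) : ℕ := sSup {c | ∃ i, Defect n lam t c i}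

/-- The smallest index at which the suffix weight of `defectCol` fails to be a partition. -/
def defectIdx (n : ℕ) (lam : ℕ → ℕ) (t : Filling) : ℕ :=
  sInf {i | Defect n lam t (defectCol n lam t) i}

/-- The involution on tableaux that are not Yamanouchi. -/
def flip (n : ℕ) (lam : ℕ → ℕ) (t : Filling) : Filling :=
  bk (defectIdx n lam t) (defectCol n lam t) t

section Flip

variable {n : ℕ} {lam : ℕ → ℕ} {t : Filling}

lemma IsSVT.not_isYamanouchi_iff (hlam : IsPartitionShape n lam) (ht : IsSVT n lam t) :
    ¬ IsYamanouchi n lam t ↔ ∃ c i, Defect n lam t c i := by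
  rw [ht.isYamanouchi_iff hlam]
  push Not
  constructor
  · rintro ⟨i, h1, h2, c, h3⟩
    exact ⟨c, i, h1, h2, h3⟩
  · rintro ⟨c, i, h1, h2, h3⟩
    exact ⟨i, h1, h2, c, h3⟩

lemma Defect.lt {c i : ℕ} (h : Defect n lam t c i) : c < lam 0 := by
  by_contra hc
  have := h.2.2
  rw [colCount_Ico_of_le (not_lt.1 hc), colCount_Ico_of_le (not_lt.1 hc)] at this
  omega

lemma isGreatest_defectCol (h : ∃ c i, Defect n lam t c i) :
    IsGreatest {c | ∃ i, Defect n lam t c i} (defectCol n lam t) := by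
  have hb : BddAbove {c | ∃ i, Defect n lam t c i} := ⟨lam 0, fun c ⟨_, hc⟩ => hc.lt.le⟩
  exact ⟨Nat.sSup_mem h hb, fun _ hc => le_csSup hb hc⟩

lemma defect_defectIdx (h : ∃ c i, Defect n lam t c i) :
    Defect n lam t (defectCol n lam t) (defectIdx n lam t) :=
  Nat.sInf_mem (s := {i | Defect n lam t (defectCol n lam t) i}) (isGreatest_defectCol h).1

lemma IsSVT.defect_spec (hlam : IsPartitionShape n lam) (ht : IsSVT n lam t)
    (h : ∃ c i, Defect n lam t c i) :
    (∀ r, defectIdx n lam t ∉ t r (defectCol n lam t)) ∧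
      colCount n t (defectIdx n lam t + 1) (Finset.Ico (defectCol n lam t) (lam 0)) =
        colCount n t (defectIdx n lam t) (Finset.Ico (defectCol n lam t) (lam 0)) + 1 := by
  have hd := defect_defectIdx h
  have hg := isGreatest_defectCol h
  set c := defectCol n lam t
  set i := defectIdx n lam t
  have h1 : ¬ Defect n lam t (c + 1) i := fun h' => by
    have := hg.2 ⟨i, h'⟩
    omega
  obtain ⟨hi, hin, hlt⟩ := id hd
  have h2 : ¬ colCount n t i (Finset.Ico (c + 1) (lam 0)) <
      colCount n t (i + 1) (Finset.Ico (c + 1) (lam 0)) := fun h' => h1 ⟨hi, hin, h'⟩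
  rw [ht.colCount_Ico_succ hlam hd.lt, ht.colCount_Ico_succ hlam hd.lt] at hlt ⊢
  have h3 : ¬ colHas n t i c := by
    intro h'
    simp only [h', if_true] at hlt
    split_ifs at hlt <;> omega
  refine ⟨fun r hr => h3 ⟨r, ht.row_lt_of_mem hlam hr, hr⟩, ?_⟩
  simp only [h3, if_false] at hlt ⊢
  split_ifs at hlt ⊢ <;> omega

lemma IsSVT.flip (hlam : IsPartitionShape n lam) (ht : IsSVT n lam t)
    (h : ∃ c i, Defect n lam t c i) : IsSVT n lam (SVTCrystal.flip n lam t) :=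
  ht.bk hlam (defect_defectIdx h).1 (defect_defectIdx h).2.1 (ht.defect_spec hlam h).1

lemma defect_flip {c i : ℕ} (hc : defectCol n lam t ≤ c) :
    Defect n lam (flip n lam t) c i ↔ Defect n lam t c i := by
  simp only [Defect, flip, colCount_bk_Ico hc]

lemma exists_defect_flip (h : ∃ c i, Defect n lam t c i) :
    ∃ c i, Defect n lam (flip n lam t) c i :=
  ⟨_, _, (defect_flip le_rfl).2 (defect_defectIdx h)⟩

lemma defectCol_flip (h : ∃ c i, Defect n lam t c i) :
    defectCol n lam (flip n lam t) = defectCol n lam t := by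
  refine IsGreatest.csSup_eq ⟨⟨_, (defect_flip le_rfl).2 (defect_defectIdx h)⟩, ?_⟩
  rintro c ⟨i, hi⟩
  by_contra hc
  exact hc ((isGreatest_defectCol h).2 ⟨i, (defect_flip (not_le.1 hc).le).1 hi⟩)

lemma defectIdx_flip (h : ∃ c i, Defect n lam t c i) :
    defectIdx n lam (flip n lam t) = defectIdx n lam t := by
  simp only [defectIdx, defectCol_flip h, defect_flip le_rfl]

lemma IsSVT.flip_flip (hlam : IsPartitionShape n lam) (ht : IsSVT n lam t)
    (h : ∃ c i, Defect n lam t c i) :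
    SVTCrystal.flip n lam (SVTCrystal.flip n lam t) = t := by
  rw [SVTCrystal.flip, defectIdx_flip h, defectCol_flip h]
  exact ht.bk_bk hlam

end Flip

/-! ### Alternants -/

/-- The weight as a vector indexed by `Fin n`. -/
def wtVec (n : ℕ) (lam : ℕ → ℕ) (t : Filling) (k : Fin n) : ℕ := wt n lam t (k + 1)

/-- The monomial in `x₁, …, xₙ` with exponent vector `α`. -/
def mono (n : ℕ) (α : Fin n → ℕ) : KPoly := ∏ j : Fin n, MvPolynomial.X (j + 1 : ℕ) ^ α j

/-- The alternant `det (x_{j} ^ {α_k})`. -/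
def alternant (n : ℕ) (α : Fin n → ℕ) : KPoly :=
  (Matrix.of fun k j : Fin n => (MvPolynomial.X (j + 1 : ℕ) : KPoly) ^ α k).det

/-- The staircase exponent vector `(n - 1, …, 1, 0)`. -/
def stair (n : ℕ) (k : Fin n) : ℕ := n - (k + 1)

section Alternant

variable {n : ℕ} {lam : ℕ → ℕ} {t : Filling}

lemma xwt_eq_mono (n : ℕ) (lam : ℕ → ℕ) (t : Filling) : xwt n lam t = mono n (wtVec n lam t) := by
  unfold xwt mono wtVec
  rw [Fin.prod_univ_eq_prod_range (fun k => (MvPolynomial.X (k + 1) : KPoly) ^ wt n lam t (k + 1)) n,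
    Finset.range_eq_Ico,
    Finset.prod_Ico_add' (fun k => (MvPolynomial.X k : KPoly) ^ wt n lam t k) 0 n 1]
  rfl

lemma mono_add (α α' : Fin n → ℕ) : mono n (α + α') = mono n α * mono n α' := by
  simp [mono, pow_add, Finset.prod_mul_distrib]

lemma alternant_eq_sum (α : Fin n → ℕ) :
    alternant n α = ∑ σ : Equiv.Perm (Fin n), Equiv.Perm.sign σ • mono n (α ∘ σ) := by
  rw [alternant, Matrix.det_apply]
  rfl

lemma alternant_comp_perm (α : Fin n → ℕ) (σ : Equiv.Perm (Fin n)) :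
    alternant n (α ∘ σ) = (Equiv.Perm.sign σ : ℤ) * alternant n α :=
  Matrix.det_permute σ (Matrix.of fun k j : Fin n => (MvPolynomial.X (j + 1 : ℕ) : KPoly) ^ α k)

lemma alternant_comp_swap (α : Fin n → ℕ) {k l : Fin n} (h : k ≠ l) :
    alternant n (α ∘ Equiv.swap k l) = - alternant n α := by
  rw [alternant_comp_perm, Equiv.Perm.sign_swap h]
  push_cast
  ring

lemma alternant_stair_ne_zero (n : ℕ) : alternant n (stair n) ≠ 0 := by
  have h : alternant n (stair n ∘ Fin.revPerm) ≠ 0 := by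
    have : alternant n (stair n ∘ Fin.revPerm) =
        (Matrix.vandermonde fun j : Fin n => (MvPolynomial.X (j + 1 : ℕ) : KPoly)).det := by
      rw [← Matrix.det_transpose, alternant]
      congr 1
      ext k j : 2
      have : n - (n - ((k : ℕ) + 1) + 1) = k := by omega
      simp [Matrix.vandermonde_apply, stair, this]
    rw [this, Matrix.det_vandermonde_ne_zero_iff]
    intro a b hab
    have := MvPolynomial.X_injective hab
    exact Fin.ext (by omega)
  rw [alternant_comp_perm] at h
  exact right_ne_zero_of_mul h

/-- The finset of all set-valued tableaux of a given shape. -/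
def svtFinset (hlam : IsPartitionShape n lam) : Finset Filling := (finite_isSVT hlam).toFinset

lemma mem_svtFinset (hlam : IsPartitionShape n lam) : t ∈ svtFinset hlam ↔ IsSVT n lam t := by
  simp [svtFinset]

lemma wtVec_bk (hlam : IsPartitionShape n lam) (ht : IsSVT n lam t) {k l : Fin n}
    (hkl : (l : ℕ) = k + 1) (ht' : IsSVT n lam (bk l (lam 0) t)) :
    wtVec n lam (bk l (lam 0) t) = wtVec n lam t ∘ Equiv.swap k l := by
  funext j
  simp only [wtVec, Function.comp]
  rw [ht.wt_bk_add hlam ht' le_rfl, colCount_Ico_of_le le_rfl, add_zero, wt_eq_colCount]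
  congr 1
  by_cases h1 : j = k
  · subst h1; rw [Equiv.swap_apply_left, ← hkl, Equiv.swap_apply_left]
  by_cases h2 : j = l
  · subst h2; rw [Equiv.swap_apply_right, Equiv.swap_apply_right, hkl]
  have h1' := Fin.val_ne_of_ne h1
  have h2' := Fin.val_ne_of_ne h2
  rw [Equiv.swap_apply_of_ne_of_ne h1 h2, Equiv.swap_apply_of_ne_of_ne (by omega) (by omega)]

lemma sum_comp_swap (hlam : IsPartitionShape n lam) (g : ℕ → KPoly) (F : (Fin n → ℕ) → KPoly)
    {k l : Fin n} (hkl : (l : ℕ) = k + 1) :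
    ∑ t ∈ svtFinset hlam, g (excess n lam t) * F (wtVec n lam t ∘ Equiv.swap k l) =
      ∑ t ∈ svtFinset hlam, g (excess n lam t) * F (wtVec n lam t) := by
  have hbk : ∀ {t}, IsSVT n lam t → IsSVT n lam (bk l (lam 0) t) := fun {t} ht =>
    ht.bk hlam (by omega) l.2 fun r h => lt_irrefl _ (ht.col_lt_of_mem hlam h)
  refine Finset.sum_nbij' (bk l (lam 0)) (bk l (lam 0)) ?_ ?_ ?_ ?_ ?_
  · exact fun t ht => (mem_svtFinset hlam).2 (hbk ((mem_svtFinset hlam).1 ht))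
  · exact fun t ht => (mem_svtFinset hlam).2 (hbk ((mem_svtFinset hlam).1 ht))
  · exact fun t ht => ((mem_svtFinset hlam).1 ht).bk_bk hlam
  · exact fun t ht => ((mem_svtFinset hlam).1 ht).bk_bk hlam
  · intro t ht
    rw [mem_svtFinset] at ht
    rw [wtVec_bk hlam ht hkl (hbk ht),
      ht.excess_bk hlam (hbk ht) (by omega) l.2 le_rfl]

lemma sum_comp_perm (hlam : IsPartitionShape n lam) (g : ℕ → KPoly) (F : (Fin n → ℕ) → KPoly)
    (σ : Equiv.Perm (Fin n)) :
    ∑ t ∈ svtFinset hlam, g (excess n lam t) * F (wtVec n lam t ∘ σ) =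
      ∑ t ∈ svtFinset hlam, g (excess n lam t) * F (wtVec n lam t) := by
  cases n with
  | zero => simp [Subsingleton.elim σ 1]
  | succ n =>
    have hσ : σ ∈ Submonoid.closure (Set.range fun i : Fin n => Equiv.swap i.castSucc i.succ) := by
      rw [Equiv.Perm.mclosure_swap_castSucc_succ]
      trivial
    induction hσ using Submonoid.closure_induction_left generalizing F with
    | one => simp
    | mul_left s hs τ hτ ih =>
      obtain ⟨k, rfl⟩ := hs
      rw [← ih, ← sum_comp_swap hlam g (fun α => F (α ∘ τ)) (k := k.castSucc) (l := k.succ)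
        (by simp)]
      rfl

lemma alternant_mul_sum (hlam : IsPartitionShape n lam) (g : ℕ → KPoly) :
    alternant n (stair n) * ∑ t ∈ svtFinset hlam, g (excess n lam t) * mono n (wtVec n lam t) =
      ∑ t ∈ svtFinset hlam, g (excess n lam t) * alternant n (stair n + wtVec n lam t) := by
  simp only [alternant_eq_sum, Finset.mul_sum (s := Finset.univ)]
  rw [Finset.sum_comm, Finset.sum_mul]
  refine Finset.sum_congr rfl fun σ _ => ?_
  rw [← sum_comp_perm hlam g (mono n) σ, Finset.mul_sum]
  refine Finset.sum_congr rfl fun t _ => ?_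
  have : (stair n + wtVec n lam t) ∘ σ = stair n ∘ σ + wtVec n lam t ∘ σ := rfl
  rw [this, mono_add, smul_mul_assoc, mul_smul_comm, mul_left_comm]

lemma alternant_flip (hlam : IsPartitionShape n lam) (ht : IsSVT n lam t)
    (h : ∃ c i, Defect n lam t c i) :
    alternant n (stair n + wtVec n lam (flip n lam t)) =
      - alternant n (stair n + wtVec n lam t) := by
  have hd := defect_defectIdx h
  have hspec := (ht.defect_spec hlam h).2
  have hf := ht.flip hlam h
  unfold flip at hf ⊢
  obtain ⟨hi, hin, -⟩ := id hd
  have hc := hd.lt.le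
  set c := defectCol n lam t
  set i := defectIdx n lam t
  have hne : (⟨i - 1, by omega⟩ : Fin n) ≠ ⟨i, hin⟩ := by
    simp only [ne_eq, Fin.mk.injEq]
    omega
  rw [← alternant_comp_swap _ hne]
  congr 1
  funext j
  simp only [Pi.add_apply, Function.comp, wtVec]
  rw [ht.wt_bk_add hlam hf hc, wt_eq_colCount, ← colCount_range_add_Ico hc]
  have hi1 : i - 1 + 1 = i := by omega
  by_cases h1 : j = ⟨i - 1, by omega⟩
  · subst h1
    simp only [Equiv.swap_apply_left, stair, hi1]
    omega
  by_cases h2 : j = ⟨i, hin⟩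
  · subst h2
    simp only [Equiv.swap_apply_right, stair, hi1]
    omega
  have h1' := Fin.val_ne_of_ne h1
  have h2' := Fin.val_ne_of_ne h2
  simp only at h1' h2'
  rw [Equiv.swap_apply_of_ne_of_ne h1 h2, Equiv.swap_apply_of_ne_of_ne (by omega) (by omega)]

lemma add_flip_eq_zero (hlam : IsPartitionShape n lam) (g : ℕ → KPoly) (ht : IsSVT n lam t)
    (h : ∃ c i, Defect n lam t c i) :
    g (excess n lam t) * alternant n (stair n + wtVec n lam t) +
      g (excess n lam (flip n lam t)) * alternant n (stair n + wtVec n lam (flip n lam t)) = 0 := by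
  have hd := defect_defectIdx h
  have he : excess n lam (flip n lam t) = excess n lam t :=
    ht.excess_bk hlam (ht.flip hlam h) hd.1 hd.2.1 hd.lt.le
  rw [alternant_flip hlam ht h, he]
  ring

/-- Multiplying the generating function of set-valued tableaux by the Vandermonde alternant
leaves only the alternants of Yamanouchi tableaux. -/
lemma alternant_mul_sum_yamanouchi (hlam : IsPartitionShape n lam) (g : ℕ → KPoly) :
    alternant n (stair n) * ∑ t ∈ svtFinset hlam, g (excess n lam t) * mono n (wtVec n lam t) =
      ∑ t ∈ (svtFinset hlam).filter (IsYamanouchi n lam),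
        g (excess n lam t) * alternant n (stair n + wtVec n lam t) := by
  rw [alternant_mul_sum, ← Finset.sum_filter_add_sum_filter_not _ (IsYamanouchi n lam),
    add_eq_left]
  have hmem : ∀ {t}, t ∈ (svtFinset hlam).filter (fun t => ¬ IsYamanouchi n lam t) ↔
      IsSVT n lam t ∧ ∃ c i, Defect n lam t c i := fun {t} => by
    rw [Finset.mem_filter, mem_svtFinset]
    exact and_congr_right fun ht => ht.not_isYamanouchi_iff hlam
  refine Finset.sum_involution (fun t _ => flip n lam t) ?_ ?_ ?_ ?_
  · intro t ht
    obtain ⟨ht, h⟩ := hmem.1 ht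
    exact add_flip_eq_zero hlam g ht h
  · intro t ht hne heq
    obtain ⟨ht, h⟩ := hmem.1 ht
    have := add_flip_eq_zero hlam g ht h
    rw [heq, add_self_eq_zero] at this
    exact hne this
  · intro t ht
    obtain ⟨ht, h⟩ := hmem.1 ht
    exact hmem.2 ⟨ht.flip hlam h, exists_defect_flip h⟩
  · intro t ht
    obtain ⟨ht, h⟩ := hmem.1 ht
    exact ht.flip_flip hlam h

end Alternant

/-! ### The Schur expansion -/

section Expansion

variable {n : ℕ} {lam : ℕ → ℕ} {t : Filling}

lemma groth_eq_sum (hlam : IsPartitionShape n lam) :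
    Groth n lam =
      ∑ t ∈ svtFinset hlam, betaP ^ excess n lam t * mono n (wtVec n lam t) := by
  rw [Groth, charSet, finsum_mem_eq_finite_toFinset_sum _ (finite_isSVT hlam)]
  simp only [xwt_eq_mono, svtFinset]

lemma schurP_eq_sum (hlam : IsPartitionShape n lam) :
    SchurP n lam =
      ∑ t ∈ svtFinset hlam,
        (if excess n lam t = 0 then 1 else 0) * mono n (wtVec n lam t) := by
  simp only [ite_mul, one_mul, zero_mul]
  rw [← Finset.sum_filter, SchurP, ← finsum_mem_coe_finset]
  refine finsum_mem_congr (Set.ext fun t => ?_) fun t _ => xwt_eq_mono n lam t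
  rw [Finset.mem_coe, Finset.mem_filter, mem_svtFinset]
  exact and_congr_right fun ht => (ht.excess_eq_zero_iff hlam).symm

/-- The bialternant formula. -/
lemma alternant_mul_schurP (hlam : IsPartitionShape n lam) :
    alternant n (stair n) * SchurP n lam = alternant n (stair n + fun k : Fin n => lam k) := by
  rw [schurP_eq_sum hlam,
    alternant_mul_sum_yamanouchi hlam (fun e => if e = 0 then 1 else 0),
    Finset.sum_eq_single_of_mem (uTab lam)]
  · rw [if_pos (excess_uTab hlam), one_mul]
    congr 2
    exact funext fun k => wt_uTab hlam k.2
  · rw [Finset.mem_filter, mem_svtFinset]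
    exact ⟨isSVT_uTab hlam, isYamanouchi_uTab hlam⟩
  · intro t ht hne
    rw [Finset.mem_filter, mem_svtFinset] at ht
    rw [if_neg, zero_mul]
    intro h0
    exact hne (ht.1.eq_uTab hlam ((ht.1.excess_eq_zero_iff hlam).1 h0) ht.2)

/-- The weight as a sequence of row lengths. -/
def wtShape (n : ℕ) (lam : ℕ → ℕ) (t : Filling) (r : ℕ) : ℕ := wt n lam t (r + 1)

lemma IsSVT.sizeOfShape_wtShape (hlam : IsPartitionShape n lam) (ht : IsSVT n lam t) :
    sizeOfShape n (wtShape n lam t) = excess n lam t + sizeOfShape n lam := by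
  rw [← ht.sum_wt hlam, sizeOfShape, Finset.range_eq_Ico]
  exact Finset.sum_Ico_add' (fun j => wt n lam t j) 0 n 1

lemma IsSVT.isPartitionShape_wtShape (hlam : IsPartitionShape n lam) (ht : IsSVT n lam t)
    (hY : IsYamanouchi n lam t) : IsPartitionShape n (wtShape n lam t) := by
  have hz : ∀ r, n ≤ r → wtShape n lam t r = 0 := fun r hr => by
    refine Finset.card_eq_zero.2 (Finset.filter_eq_empty_iff.2 fun p _ hp => ?_)
    have := (ht.entryBounds _ _ _ hp).2
    omega
  refine ⟨fun r => ?_, hz⟩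
  rcases Nat.lt_or_ge (r + 1) n with h | h
  · have := (ht.isYamanouchi_iff hlam).1 hY (r + 1) (by omega) h 0
    rwa [← Finset.range_eq_Ico] at this
  · rw [hz _ h]
    exact Nat.zero_le _

lemma mcoef_eq_card (hlam : IsPartitionShape n lam) (mu : ℕ → ℕ) :
    Mcoef n lam mu = (((svtFinset hlam).filter (IsYamanouchi n lam)).filter
      (fun t => wtShape n lam t = mu)).card := by
  refine Nat.subtype_card _ fun t => ?_
  rw [Finset.mem_filter, Finset.mem_filter, mem_svtFinset, and_assoc]
  exact and_congr_right fun _ => and_congr_right fun _ => funext_iff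

lemma sizeOfShape_le_of_mcoef_ne_zero (hlam : IsPartitionShape n lam) {mu : ℕ → ℕ}
    (h : Mcoef n lam mu ≠ 0) : sizeOfShape n lam ≤ sizeOfShape n mu := by
  rw [mcoef_eq_card hlam, Finset.card_ne_zero] at h
  obtain ⟨t, ht⟩ := h
  simp only [Finset.mem_filter, mem_svtFinset] at ht
  obtain ⟨⟨ht, -⟩, rfl⟩ := ht
  rw [ht.sizeOfShape_wtShape hlam]
  exact Nat.le_add_left _ _

/-- Yamanouchi tableaux of a common weight contribute a multiple of a Schur polynomial. -/
lemma sum_fiber (hlam : IsPartitionShape n lam) {mu : ℕ → ℕ} (hmu : IsPartitionShape n mu) :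
    ∑ t ∈ ((svtFinset hlam).filter (IsYamanouchi n lam)).filter (fun t => wtShape n lam t = mu),
        betaP ^ excess n lam t * alternant n (stair n + wtVec n lam t) =
      alternant n (stair n) *
        (Mcoef n lam mu * betaP ^ (sizeOfShape n mu - sizeOfShape n lam) * SchurP n mu) := by
  have h : ∀ t ∈ ((svtFinset hlam).filter (IsYamanouchi n lam)).filter
      (fun t => wtShape n lam t = mu),
      betaP ^ excess n lam t * alternant n (stair n + wtVec n lam t) =
        betaP ^ (sizeOfShape n mu - sizeOfShape n lam) *
          alternant n (stair n + fun k : Fin n => mu k) := by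
    intro t ht
    simp only [Finset.mem_filter, mem_svtFinset] at ht
    obtain ⟨⟨ht, -⟩, rfl⟩ := ht
    have he : sizeOfShape n (wtShape n lam t) - sizeOfShape n lam = excess n lam t := by
      rw [ht.sizeOfShape_wtShape hlam, Nat.add_sub_cancel]
    rw [he]
    rfl
  rw [Finset.sum_congr rfl h, Finset.sum_const, ← mcoef_eq_card hlam, ← alternant_mul_schurP hmu,
    nsmul_eq_mul]
  ring

end Expansion

/-- the Schur expansion
`𝔊_λ(x₁,…,xₙ;β) = ∑_μ β^{|μ|-|λ|} M_λ^μ s_μ(x₁,…,xₙ)`, where `M_λ^μ` counts Yamanouchi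
set-valued tableaux of shape `λ` and weight `μ`, and `M_λ^μ = 0` unless `|μ| ≥ |λ|`. -/
theorem groth_schur_expansion (n : ℕ) (lam : ℕ → ℕ) (hlam : IsPartitionShape n lam) :
    (∀ mu : ℕ → ℕ, IsPartitionShape n mu →
      sizeOfShape n mu < sizeOfShape n lam → Mcoef n lam mu = 0) ∧
    Groth n lam =
      ∑ᶠ mu ∈ {mu : ℕ → ℕ | IsPartitionShape n mu},
        (Mcoef n lam mu : KPoly) *
          betaP ^ (sizeOfShape n mu - sizeOfShape n lam) * SchurP n mu := by
  refine ⟨fun mu _ hlt => ?_, ?_⟩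
  · by_contra h
    exact absurd (sizeOfShape_le_of_mcoef_ne_zero hlam h) (not_le.2 hlt)
  set Y := (svtFinset hlam).filter (IsYamanouchi n lam) with hY
  have hYmem : ∀ {t}, t ∈ Y ↔ IsSVT n lam t ∧ IsYamanouchi n lam t := fun {t} => by
    rw [hY, Finset.mem_filter, mem_svtFinset]
  rw [finsum_mem_eq_sum_of_subset (t := Y.image (wtShape n lam))]
  · apply mul_left_cancel₀ (alternant_stair_ne_zero n)
    rw [groth_eq_sum hlam, alternant_mul_sum_yamanouchi hlam (fun e => betaP ^ e), Finset.mul_sum,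
      ← Finset.sum_fiberwise_of_maps_to (g := wtShape n lam) (t := Y.image (wtShape n lam))
        (fun t ht => Finset.mem_image_of_mem _ ht)]
    refine Finset.sum_congr rfl fun mu hmu => ?_
    obtain ⟨t₀, ht₀, rfl⟩ := Finset.mem_image.1 hmu
    rw [hYmem] at ht₀
    exact sum_fiber hlam (ht₀.1.isPartitionShape_wtShape hlam ht₀.2)
  · rintro mu ⟨-, hsupp⟩
    have hM : Mcoef n lam mu ≠ 0 := fun h => hsupp (by simp [h])
    rw [mcoef_eq_card hlam, Finset.card_ne_zero] at hM
    obtain ⟨t, ht⟩ := hM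
    rw [Finset.mem_filter] at ht
    exact Finset.mem_coe.2 (Finset.mem_image.2 ⟨t, ht⟩)
  · intro mu hmu
    obtain ⟨t, ht, rfl⟩ := Finset.mem_image.1 (Finset.mem_coe.1 hmu)
    rw [hYmem] at ht
    exact ht.1.isPartitionShape_wtShape hlam ht.2

end SVTCrystal

end
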